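/- arXiv:2312.04128 — 2 statements merged into one kernel-verified Lean document; each statement's English description precedes it below -/
import Mathlib

section
/- Let N be an affine subspace of ℝ^m with codimension at least 2, and let r ≥ 1 be a constant. Then for every x, y ∈ ℝ^m \ N there exists a point w ∈ ℝ^m \ N such that |x − w| + |w − y| ≤ 3 |x − y|, and for every ξ ∈ [x, w] ∪ [w, y] one has 2r · dist(ξ, N) ≥ min{dist(x, N), dist(y, N)} ≥ r · dist(ξ, [x, y]). -/
open Metric Set

noncomputable section

section Detour

variable {E : Type*} [NormedAddCommGroup E] [InnerProductSpace ℝ E]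

lemma half_le_norm_combo_add_smul {u p e : E} {h t : ℝ} (hh : 0 ≤ h) (hu : h ≤ ‖u‖)
    (hp : ‖p‖ ≤ h / 2) (he : ‖e‖ = 1) (hue : 0 ≤ inner ℝ u e) (hpe : 0 ≤ inner ℝ p e)
    (ht₀ : 0 ≤ t) (ht₁ : t ≤ 1) :
    h / 2 ≤ ‖(1 - t) • u + t • (p + h • e)‖ := by
  set q := (1 - t) • u + t • p with hq
  have h_eq : (1 - t) • u + t • (p + h • e) = q + (t * h) • e := by rw [hq]; module
  have hqe : 0 ≤ inner ℝ q e := by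
    rw [hq, inner_add_left, real_inner_smul_left, real_inner_smul_left]
    have : 0 ≤ 1 - t := by linarith
    positivity
  have h_sq : ‖q‖ ^ 2 + (t * h) ^ 2 ≤ ‖q + (t * h) • e‖ ^ 2 := by
    rw [norm_add_sq_real q, real_inner_smul_right, norm_smul (t * h), he, mul_one,
      Real.norm_eq_abs, sq_abs]
    have : 0 ≤ 2 * (t * h * inner ℝ q e) := by positivity
    linarith
  have h_lower : (1 - 3 / 2 * t) * h ≤ ‖q‖ := by
    have h_tri : ‖(1 - t) • u‖ ≤ ‖q‖ + ‖t • p‖ := by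
      have := norm_sub_le q (t • p)
      rwa [hq, add_sub_cancel_right] at this
    rw [norm_smul, norm_smul, Real.norm_of_nonneg ht₀,
      Real.norm_of_nonneg (by linarith : 0 ≤ 1 - t)] at h_tri
    nlinarith [mul_le_mul_of_nonneg_left hu (by linarith : 0 ≤ 1 - t),
      mul_le_mul_of_nonneg_left hp ht₀]
  rw [h_eq]
  refine le_of_sq_le_sq (h_sq.trans' ?_) (norm_nonneg _)
  rcases le_total (1 / 2) t with ht | ht
  · have : 1 / 2 * h ≤ t * h := by gcongr
    nlinarith [sq_nonneg ‖q‖]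
  · have h_nonneg : 0 ≤ (1 - 3 / 2 * t) * h := mul_nonneg (by linarith) hh
    have h_pow : ((1 - 3 / 2 * t) * h) ^ 2 ≤ ‖q‖ ^ 2 := by gcongr
    have h_poly : (1 / 4 : ℝ) ≤ (1 - 3 / 2 * t) ^ 2 + t ^ 2 := by
      nlinarith [sq_nonneg (t - 6 / 13)]
    nlinarith [mul_le_mul_of_nonneg_right h_poly (sq_nonneg h)]

lemma infDist_eq_norm_starProjection [FiniteDimensional ℝ E] (N : AffineSubspace ℝ E) {o : E}
    (ho : o ∈ N) (ξ : E) :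
    infDist ξ (N : Set E) = ‖N.directionᗮ.starProjection (ξ - o)‖ := by
  have : Nonempty N := ⟨⟨o, ho⟩⟩
  rw [← EuclideanGeometry.dist_orthogonalProjection_eq_infDist, dist_eq_norm]
  congr 1
  set p : E := ↑(EuclideanGeometry.orthogonalProjection N ξ)
  have h_perp : ξ - p ∈ N.directionᗮ :=
    EuclideanGeometry.vsub_orthogonalProjection_mem_direction_orthogonal N ξ
  have h_dir : p - o ∈ N.direction :=
    AffineSubspace.vsub_mem_direction (EuclideanGeometry.orthogonalProjection_mem ξ) ho
  rw [← sub_add_sub_cancel ξ p o, map_add, Submodule.starProjection_eq_self_iff.2 h_perp,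
    (Submodule.starProjection_apply_eq_zero_iff _).2 (by simpa using h_dir), add_zero]

lemma half_le_infDist_of_mem_segment [FiniteDimensional ℝ E] {N : AffineSubspace ℝ E}
    {o x z e ξ : E} {h : ℝ} (ho : o ∈ N) (hh : 0 ≤ h) (hx : h ≤ infDist x (N : Set E))
    (hz : infDist z (N : Set E) ≤ h / 2) (he : ‖e‖ = 1) (he_perp : e ∈ N.directionᗮ)
    (hxe : 0 ≤ inner ℝ (x - o) e) (hze : 0 ≤ inner ℝ (z - o) e)
    (hξ : ξ ∈ segment ℝ x (z + h • e)) :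
    h / 2 ≤ infDist ξ (N : Set E) := by
  obtain ⟨t, ⟨ht₀, ht₁⟩, rfl⟩ := (segment_eq_image ℝ x (z + h • e)) ▸ hξ
  have h_fix : N.directionᗮ.starProjection e = e := Submodule.starProjection_eq_self_iff.2 he_perp
  have h_inner (v : E) : inner ℝ (N.directionᗮ.starProjection v) e = inner ℝ v e := by
    rw [Submodule.inner_starProjection_left_eq_right, h_fix]
  have h_split : (1 - t) • x + t • (z + h • e) - o
      = (1 - t) • (x - o) + t • ((z - o) + h • e) := by module
  simp only [infDist_eq_norm_starProjection N ho] at hx hz ⊢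
  rw [h_split, map_add, map_smul, map_smul, map_add, map_smul, h_fix]
  exact half_le_norm_combo_add_smul hh hx hz he (by rwa [h_inner]) (by rwa [h_inner]) ht₀ ht₁

lemma infDist_segment_le_of_mem_segment_add {x y z v ξ : E} (hz : z ∈ segment ℝ x y)
    (hξ : ξ ∈ segment ℝ x (z + v)) : infDist ξ (segment ℝ x y) ≤ ‖v‖ := by
  obtain ⟨t, ⟨ht₀, ht₁⟩, rfl⟩ := (segment_eq_image ℝ x (z + v)) ▸ hξ
  have h_mem : (1 - t) • x + t • z ∈ segment ℝ x y :=
    convex_segment x y (left_mem_segment ℝ x y) hz (by linarith) ht₀ (by ring)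
  refine (infDist_le_dist_of_mem h_mem).trans ?_
  have h_eq : (1 - t) • x + t • (z + v) - ((1 - t) • x + t • z) = t • v := by module
  rw [dist_eq_norm, h_eq, norm_smul, Real.norm_of_nonneg ht₀]
  exact mul_le_of_le_one_left (norm_nonneg v) ht₁

lemma exists_unit_mem_orthogonal_inner_nonneg [FiniteDimensional ℝ E] {K : Submodule ℝ E}
    (hK : Module.finrank ℝ K + 2 ≤ Module.finrank ℝ E) (a b : E) :
    ∃ e ∈ Kᗮ, ‖e‖ = 1 ∧ inner ℝ a e = 0 ∧ 0 ≤ inner ℝ b e := by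
  have h_ne : (K ⊔ ℝ ∙ a)ᗮ ≠ ⊥ := by
    rw [Ne, Submodule.orthogonal_eq_bot_iff]
    intro h_top
    have h_le := Submodule.finrank_add_le_finrank_add_finrank K (ℝ ∙ a)
    have h_one : Module.finrank ℝ (ℝ ∙ a) ≤ 1 := by
      simpa using finrank_span_le_card (R := ℝ) ({a} : Set E)
    rw [h_top, finrank_top] at h_le
    omega
  obtain ⟨f, hf, hf₀⟩ := Submodule.exists_mem_ne_zero_of_ne_bot h_ne
  have h_unit : ‖(‖f‖⁻¹ : ℝ) • f‖ = 1 := by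
    simpa using norm_smul_inv_norm (𝕜 := ℝ) hf₀
  have h_mem : (‖f‖⁻¹ : ℝ) • f ∈ (K ⊔ ℝ ∙ a)ᗮ := Submodule.smul_mem _ _ hf
  set g := (‖f‖⁻¹ : ℝ) • f
  have h_perp : g ∈ Kᗮ := Submodule.orthogonal_le le_sup_left h_mem
  have h_inner : inner ℝ a g = 0 := Submodule.inner_right_of_mem_orthogonal
    (Submodule.mem_sup_right (Submodule.mem_span_singleton_self a)) h_mem
  rcases le_total 0 (inner ℝ b g) with hb | hb
  · exact ⟨g, h_perp, h_unit, h_inner, hb⟩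
  · exact ⟨-g, Submodule.neg_mem _ h_perp, by rwa [norm_neg],
      by rw [inner_neg_right, h_inner, neg_zero], by rw [inner_neg_right]; linarith⟩

end Detour

theorem detour_point_around_codim_two_affine_subspace
    (m : ℕ)
    (N : AffineSubspace ℝ (EuclideanSpace ℝ (Fin m)))
    (hNne : (N : Set (EuclideanSpace ℝ (Fin m))).Nonempty)
    (hcodim : Module.finrank ℝ N.direction + 2 ≤ m)
    (r : ℝ) (hr : 1 ≤ r)
    (x y : EuclideanSpace ℝ (Fin m))
    (hx : x ∉ (N : Set (EuclideanSpace ℝ (Fin m))))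
    (hy : y ∉ (N : Set (EuclideanSpace ℝ (Fin m)))) :
    ∃ w : EuclideanSpace ℝ (Fin m), w ∉ (N : Set (EuclideanSpace ℝ (Fin m))) ∧
      ‖x - w‖ + ‖w - y‖ ≤ 3 * ‖x - y‖ ∧
      ∀ ξ ∈ segment ℝ x w ∪ segment ℝ w y,
        min (infDist x (N : Set (EuclideanSpace ℝ (Fin m))))
            (infDist y (N : Set (EuclideanSpace ℝ (Fin m)))) ≤
          2 * r * infDist ξ (N : Set (EuclideanSpace ℝ (Fin m))) ∧
        r * infDist ξ (segment ℝ x y) ≤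
          min (infDist x (N : Set (EuclideanSpace ℝ (Fin m))))
            (infDist y (N : Set (EuclideanSpace ℝ (Fin m)))) := by
  obtain ⟨o, ho⟩ := hNne
  have h_closed : IsClosed (N : Set (EuclideanSpace ℝ (Fin m))) :=
    AffineSubspace.closed_of_finiteDimensional N
  have h_pos {v : EuclideanSpace ℝ (Fin m)} :
      v ∉ (N : Set (EuclideanSpace ℝ (Fin m))) ↔ 0 < infDist v N :=
    h_closed.notMem_iff_infDist_pos ⟨o, ho⟩
  set d := min (infDist x (N : Set (EuclideanSpace ℝ (Fin m)))) (infDist y N)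
  have hd₀ : 0 < d := lt_min (h_pos.1 hx) (h_pos.1 hy)
  have hr₀ : 0 < r := by linarith
  by_cases h_far : ∀ z ∈ segment ℝ x y, d / r / 2 ≤ infDist z N
  · refine ⟨x, hx, ?_, fun ξ hξ ↦ ?_⟩
    · rw [sub_self, norm_zero]
      linarith [norm_nonneg (x - y)]
    · have h_mem : ξ ∈ segment ℝ x y := by
        rcases hξ with hξ | hξ
        · rw [segment_same] at hξ
          exact hξ ▸ left_mem_segment ℝ x y
        · exact hξ
      refine ⟨?_, by rw [infDist_zero_of_mem h_mem, mul_zero]; exact hd₀.le⟩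
      have := h_far ξ h_mem
      rw [div_div, div_le_iff₀ (by positivity)] at this
      linarith
  push Not at h_far
  obtain ⟨z, hz, hz_near⟩ := h_far
  set h := d / r with hh
  have hh₀ : 0 < h := div_pos hd₀ hr₀
  have h_rh : r * h = d := by rw [hh]; field_simp
  have hh_le : h ≤ d := div_le_self hd₀.le hr
  have hhx : h ≤ infDist x N := hh_le.trans (min_le_left _ _)
  have hhy : h ≤ infDist y N := hh_le.trans (min_le_right _ _)
  obtain ⟨e, he_perp, he, he_xy, he_x⟩ := exists_unit_mem_orthogonal_inner_nonneg
    (K := N.direction) (by simpa using hcodim) (y - x) (x - o)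
  have h_shift (s : ℝ) : inner ℝ (x + s • (y - x) - o) e = inner ℝ (x - o) e := by
    rw [add_sub_right_comm, inner_add_left, real_inner_smul_left, he_xy, mul_zero, add_zero]
  have he_y : 0 ≤ inner ℝ (y - o) e := by
    have := h_shift 1
    rw [one_smul, add_sub_cancel] at this
    rwa [this]
  have he_z : 0 ≤ inner ℝ (z - o) e := by
    obtain ⟨s, -, rfl⟩ := (segment_eq_image' ℝ x y) ▸ hz
    exact he_x.trans_eq (h_shift s).symm
  have h_norm : ‖h • e‖ = h := by rw [norm_smul, he, mul_one, Real.norm_of_nonneg hh₀.le]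
  have h_avoid : ∀ ξ ∈ segment ℝ x (z + h • e) ∪ segment ℝ (z + h • e) y,
      h / 2 ≤ infDist ξ N := by
    rintro ξ (hξ | hξ)
    · exact half_le_infDist_of_mem_segment ho hh₀.le hhx hz_near.le he he_perp he_x he_z hξ
    · rw [segment_symm] at hξ
      exact half_le_infDist_of_mem_segment ho hh₀.le hhy hz_near.le he he_perp he_y he_z hξ
  refine ⟨z + h • e, ?_, ?_, fun ξ hξ ↦ ⟨?_, ?_⟩⟩
  · exact h_pos.2 ((half_pos hh₀).trans_le (h_avoid _ (Or.inl (right_mem_segment ℝ _ _))))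
  · have h_add := dist_add_dist_of_mem_segment hz
    have hxz : infDist x N ≤ infDist z N + dist x z := infDist_le_infDist_add_dist
    have hyz : infDist y N ≤ infDist z N + dist y z := infDist_le_infDist_add_dist
    have hxw : ‖x - (z + h • e)‖ ≤ ‖x - z‖ + h := by
      rw [← sub_sub]
      exact (norm_sub_le _ _).trans_eq (by rw [h_norm])
    have hwy : ‖z + h • e - y‖ ≤ ‖z - y‖ + h := by
      rw [add_sub_right_comm]
      exact (norm_add_le _ _).trans_eq (by rw [h_norm])
    rw [dist_comm y z] at hyz
    simp only [dist_eq_norm] at h_add hxz hyz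
    linarith
  · have := h_avoid ξ hξ
    nlinarith
  · have h_near : infDist ξ (segment ℝ x y) ≤ h := by
      rcases hξ with hξ | hξ
      · exact (infDist_segment_le_of_mem_segment_add hz hξ).trans_eq h_norm
      · rw [segment_symm] at hξ hz ⊢
        exact (infDist_segment_le_of_mem_segment_add hz hξ).trans_eq h_norm
    rw [← h_rh]
    gcongr
end
end

section
/- Let H₁, …, H_p be hyperplanes in ℝ^m and set H = H₁ ∪ ⋯ ∪ H_p. Let N ⊂ H be a closed set, let B ≥ 1, α > 0, C₁ > 0 be constants, and let d be a B-pseudometric on 𝔹^m \ N (where 𝔹^m is the open unit ball of ℝ^m). Assume that for every connected component U of 𝔹^m \ H and every x, y ∈ (closure of U) ∩ (𝔹^m \ N) one has d(x, y) ≤ C₁ / |log |x − y||^α. Then for every x, y ∈ 𝔹^m \ N such that the segment [x, y] meets H but does not meet N, one has d(x, y) ≤ (p + 1) · B · C₁ / |log |x − y||^α. -/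
open Metric Set

noncomputable section

/-- A `B`-pseudometric on a set `Z`: vanishes on the diagonal, nonnegative, symmetric,
continuous on `Z × Z`, and satisfies the `B`-weakened chain (triangle) inequality. -/
def IsBPseudometric {E : Type*} [NormedAddCommGroup E] (d : E → E → ℝ) (Z : Set E)
    (B : ℝ) : Prop :=
  (∀ x ∈ Z, d x x = 0) ∧
  (∀ x ∈ Z, ∀ y ∈ Z, 0 ≤ d x y) ∧
  (∀ x ∈ Z, ∀ y ∈ Z, d x y = d y x) ∧
  ContinuousOn (fun p : E × E => d p.1 p.2) (Z ×ˢ Z) ∧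
  (∀ (k : ℕ) (x : ℕ → E), (∀ i, i ≤ k → x i ∈ Z) →
    d (x 0) (x k) ≤ B * ∑ j ∈ Finset.range k, d (x j) (x (j + 1)))

/-- An affine function `β * t + c` has no sign change on an interval `(s, s')` avoiding its root
(clamped to `[0, 1]`), and vanishes identically if it vanishes at the midpoint. -/
lemma affine_sign_of_clamped_root_notMem {β c s s' : ℝ} (hs : 0 ≤ s) (hss : s < s') (hs' : s' ≤ 1)
    (hroot : ¬ (s < max 0 (min 1 (-c / β)) ∧ max 0 (min 1 (-c / β)) < s')) :
    0 ≤ (β * s + c) * (β * ((s + s') / 2) + c) ∧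
    0 ≤ (β * s' + c) * (β * ((s + s') / 2) + c) ∧
    (β * ((s + s') / 2) + c = 0 → β * s + c = 0 ∧ β * s' + c = 0) := by
  rcases eq_or_ne β 0 with rfl | hβ
  · simp [mul_self_nonneg]
  obtain ⟨r, hr⟩ : ∃ r, r = -c / β := ⟨_, rfl⟩
  rw [← hr] at hroot
  have hc : c = -(β * r) := by rw [hr]; field_simp
  have hr' : r ≤ s ∨ s' ≤ r := by
    by_contra! h
    apply hroot
    rw [min_eq_right (by linarith), max_eq_right (by linarith)]
    exact h
  have hfac : ∀ t, β * t + c = β * (t - r) := fun t => by rw [hc]; ring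
  have hprod : ∀ t u, 0 ≤ (t - r) * (u - r) → 0 ≤ (β * t + c) * (β * u + c) := fun t u h => by
    rw [hfac, hfac]
    nlinarith [mul_nonneg (mul_self_nonneg β) h]
  refine ⟨hprod _ _ ?_, hprod _ _ ?_, fun h => ?_⟩
  · rcases hr' with h | h
    · exact mul_nonneg (by linarith) (by linarith)
    · exact mul_nonneg_of_nonpos_of_nonpos (by linarith) (by linarith)
  · rcases hr' with h | h
    · exact mul_nonneg (by linarith) (by linarith)
    · exact mul_nonneg_of_nonpos_of_nonpos (by linarith) (by linarith)
  · rw [hfac] at h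
    have := (mul_eq_zero.mp h).resolve_left hβ
    rcases hr' with h | h <;> linarith

/-- Finitely many points of `[0, 1]` cut it into consecutive intervals whose interiors contain none
of them. -/
lemma exists_monotone_subdivision {p : ℕ} (t : Fin p → ℝ) (h0 : ∀ i, 0 ≤ t i)
    (h1 : ∀ i, t i ≤ 1) :
    ∃ s : ℕ → ℝ, Monotone s ∧ s 0 = 0 ∧ s (p + 1) = 1 ∧ (∀ j, s j ∈ Icc (0 : ℝ) 1) ∧
      ∀ j i, ¬ (s j < t i ∧ t i < s (j + 1)) := by
  let s : ℕ → ℝ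
    | 0 => 0
    | k + 1 => if h : k < p then t (Tuple.sort t ⟨k, h⟩) else 1
  have hsucc : ∀ k (h : k < p), s (k + 1) = t (Tuple.sort t ⟨k, h⟩) := fun k h => dif_pos h
  have hlast : ∀ k, ¬ k < p → s (k + 1) = 1 := fun k h => dif_neg h
  have hmem : ∀ j, s j ∈ Icc (0 : ℝ) 1 := by
    rintro (_ | k)
    · exact ⟨le_rfl, zero_le_one⟩
    · by_cases h : k < p
      · rw [hsucc k h]; exact ⟨h0 _, h1 _⟩
      · rw [hlast k h]; exact ⟨zero_le_one, le_rfl⟩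
  have hmono : Monotone s := by
    refine monotone_nat_of_le_succ ?_
    rintro (_ | k)
    · exact (hmem 1).1
    · by_cases h : k + 1 < p
      · rw [hsucc k (by omega), hsucc (k + 1) h]
        exact Tuple.monotone_sort t (Fin.mk_le_mk.mpr k.le_succ)
      · rw [hlast (k + 1) h]
        exact (hmem (k + 1)).2
  refine ⟨s, hmono, rfl, hlast p (lt_irrefl p), hmem, ?_⟩
  rintro j i ⟨hl, hr⟩
  obtain ⟨⟨k, hk⟩, rfl⟩ := (Tuple.sort t).surjective i
  rw [← hsucc k hk] at hl hr
  have h₁ := hmono.reflect_lt (a := j) (b := k + 1) hl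
  have h₂ := hmono.reflect_lt (a := k + 1) (b := j + 1) hr
  omega

/-- A point lies in the closure of the component of `z` in `K \ S` if no affine function from a
family whose zero sets cover `S` separates it from `z`. -/
lemma mem_closure_connectedComponentIn_diff {E ι : Type*} [NormedAddCommGroup E] [NormedSpace ℝ E]
    {K S : Set E} (hK : Convex ℝ K) (f : ι → E →ᵃ[ℝ] ℝ) (hS : ∀ w ∈ S, ∃ i, f i w = 0)
    {z a : E} (hz : z ∈ K) (ha : a ∈ K) (hfz : ∀ i, f i z ≠ 0) (hfa : ∀ i, 0 ≤ f i a * f i z) :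
    a ∈ closure (connectedComponentIn (K \ S) z) := by
  have hconv : Convex ℝ (K ∩ ⋂ i, {w | 0 < f i w * f i z}) := by
    refine hK.inter (convex_iInter fun i => ?_)
    have h := (convex_Ioi (0 : ℝ)).affine_preimage (f i z • f i)
    have heq : {w | 0 < f i w * f i z} = (f i z • f i) ⁻¹' Ioi 0 := by
      ext w
      simp [mul_comm]
    rw [heq]
    exact h
  have hsub : K ∩ ⋂ i, {w | 0 < f i w * f i z} ⊆ K \ S := by
    rintro w ⟨hwK, hw⟩
    refine ⟨hwK, fun hwS => ?_⟩
    obtain ⟨i, hi⟩ := hS w hwS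
    have := mem_iInter.mp hw i
    simp [hi] at this
  have hzz : z ∈ K ∩ ⋂ i, {w | 0 < f i w * f i z} :=
    ⟨hz, mem_iInter.mpr fun i => mul_self_pos.mpr (hfz i)⟩
  have hseg : openSegment ℝ a z ⊆ K ∩ ⋂ i, {w | 0 < f i w * f i z} := by
    rintro w ⟨u, v, hu, hv, huv, rfl⟩
    refine ⟨hK ha hz hu.le hv.le huv, mem_iInter.mpr fun i => ?_⟩
    have hcomb : f i (u • a + v • z) = u * f i a + v * f i z := by
      simpa using Convex.combo_affine_apply (f := f i) (x := a) (y := z) huv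
    have h₁ := mul_nonneg hu.le (hfa i)
    have h₂ := mul_pos hv (mul_self_pos.mpr (hfz i))
    simp only [mem_ofPred_eq, hcomb]
    linarith
  refine closure_mono
    (hseg.trans (hconv.isPreconnected.subset_connectedComponentIn hzz hsub)) ?_
  rw [closure_openSegment]
  exact left_mem_segment ℝ a z

/-- A proper nonempty affine subspace is contained in the zero set of a nonconstant affine
function. -/
lemma AffineSubspace.exists_affineMap_eq_zero {E : Type*} [AddCommGroup E] [Module ℝ E]
    (H : AffineSubspace ℝ E) (hne : (H : Set E).Nonempty) (hH : H.direction < ⊤) :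
    ∃ f : E →ᵃ[ℝ] ℝ, f.linear ≠ 0 ∧ ∀ w ∈ H, f w = 0 := by
  obtain ⟨q, hq⟩ := hne
  obtain ⟨L, hL, hker⟩ := Submodule.exists_le_ker_of_lt_top _ hH
  refine ⟨L.toAffineMap - AffineMap.const ℝ E (L q), by simpa using hL, fun w hw => ?_⟩
  have := hker (AffineSubspace.vsub_mem_direction hw hq)
  simpa using this

/-- Two points of an open convex set such that no member of a finite family of nonconstant affine
functions changes sign between them lie in the closure of a common component of the complement of
the zero sets. -/
lemma exists_mem_closure_connectedComponentIn_diff {E ι : Type*} [Finite ι]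
    [NormedAddCommGroup E] [NormedSpace ℝ E] {K S : Set E} (hK : Convex ℝ K) (hKo : IsOpen K)
    (f : ι → E →ᵃ[ℝ] ℝ) (hf : ∀ i, (f i).linear ≠ 0) (hS : ∀ w ∈ S, ∃ i, f i w = 0)
    {a b c : E} (ha : a ∈ K) (hb : b ∈ K) (hc : c ∈ K)
    (hac : ∀ i, 0 ≤ f i a * f i c) (hbc : ∀ i, 0 ≤ f i b * f i c)
    (h0 : ∀ i, f i c = 0 → f i a = 0 ∧ f i b = 0) :
    ∃ z ∈ K \ S, a ∈ closure (connectedComponentIn (K \ S) z) ∧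
      b ∈ closure (connectedComponentIn (K \ S) z) := by
  obtain ⟨v, hv⟩ := Module.Dual.exists_forall_ne_zero_of_forall_exists
    (fun i => (f i).linear) (fun i => by
      by_contra! h
      exact hf i (LinearMap.ext h))
  have hval : ∀ i (ε : ℝ), f i (c + ε • v) = f i c + ε * (f i).linear v := fun i ε => by
    rw [add_comm c, ← vadd_eq_add, AffineMap.map_vadd]
    simp [add_comm]
  have hK' : ∀ᶠ ε : ℝ in nhdsWithin 0 (Ioi 0), c + ε • v ∈ K := by
    have : ContinuousAt (fun ε : ℝ => c + ε • v) 0 := by fun_prop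
    exact (this.eventually (by simpa using hKo.mem_nhds hc)).filter_mono nhdsWithin_le_nhds
  have hpos : ∀ᶠ ε : ℝ in nhdsWithin 0 (Ioi 0),
      ∀ i, f i c ≠ 0 → 0 < f i c * f i (c + ε • v) := by
    refine Filter.eventually_all.mpr fun i => ?_
    by_cases hi : f i c = 0
    · simp [hi]
    have hcont : ContinuousAt (fun ε : ℝ => f i c * f i (c + ε • v)) 0 := by
      simp only [hval]; fun_prop
    have : ∀ᶠ ε : ℝ in nhds 0, 0 < f i c * f i (c + ε • v) :=
      hcont.eventually (lt_mem_nhds (by simpa using hi))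
    exact (this.filter_mono nhdsWithin_le_nhds).mono fun _ h _ => h
  obtain ⟨ε, ⟨hεK, hεpos⟩, hε⟩ := ((hK'.and hpos).and self_mem_nhdsWithin).exists
  have hε : 0 < ε := hε
  have hne : ∀ i, f i (c + ε • v) ≠ 0 := fun i => by
    by_cases hi : f i c = 0
    · rw [hval, hi, zero_add]
      exact mul_ne_zero hε.ne' (hv i)
    · exact right_ne_zero_of_mul (hεpos i hi).ne'
  have key : ∀ i (r : ℝ), 0 ≤ r * f i c → (f i c = 0 → r = 0) →
      0 ≤ r * f i (c + ε • v) := fun i r hr hr0 => by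
    by_cases hi : f i c = 0
    · simp [hr0 hi]
    · have h := mul_nonneg hr (hεpos i hi).le
      have hsq : 0 < f i c * f i c := mul_self_pos.mpr hi
      refine nonneg_of_mul_nonneg_right (?_ : 0 ≤ (f i c * f i c) * _) hsq
      linarith
  refine ⟨c + ε • v, ⟨hεK, fun h => ?_⟩, ?_, ?_⟩
  · obtain ⟨i, hi⟩ := hS _ h
    exact hne i hi
  · exact mem_closure_connectedComponentIn_diff hK f hS hεK ha hne
      fun i => key i _ (hac i) fun h => (h0 i h).1
  · exact mem_closure_connectedComponentIn_diff hK f hS hεK hb hne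
      fun i => key i _ (hbc i) fun h => (h0 i h).2

/-- The bound `C / |log r| ^ α` is increasing in `r ∈ (0, 1)`. -/
lemma div_abs_log_rpow_le {C α r r' : ℝ} (hC : 0 ≤ C) (hα : 0 ≤ α) (hr : 0 < r) (hrr : r ≤ r')
    (hr' : r' < 1) : C / |Real.log r| ^ α ≤ C / |Real.log r'| ^ α := by
  have hlog := Real.log_neg (hr.trans_le hrr) hr'
  have hle := Real.log_le_log hr hrr
  have : 0 < |Real.log r'| := abs_pos.mpr hlog.ne
  have : |Real.log r'| ≤ |Real.log r| := by
    rw [abs_of_neg hlog, abs_of_neg (hle.trans_lt hlog)]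
    linarith
  gcongr

theorem log_bound_across_hyperplanes
    (m p : ℕ) (hm : 2 ≤ m)
    (H : Fin p → AffineSubspace ℝ (EuclideanSpace ℝ (Fin m)))
    (hHne : ∀ i, (H i : Set (EuclideanSpace ℝ (Fin m))).Nonempty)
    (hHhyp : ∀ i, Module.finrank ℝ (H i).direction + 1 = m)
    (Nset : Set (EuclideanSpace ℝ (Fin m))) (hNclosed : IsClosed Nset)
    (hNsub : Nset ⊆ ⋃ i, (H i : Set (EuclideanSpace ℝ (Fin m))))
    (B α C₁ : ℝ) (hB : 1 ≤ B) (hα : 0 < α) (hC₁ : 0 < C₁)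
    (d : EuclideanSpace ℝ (Fin m) → EuclideanSpace ℝ (Fin m) → ℝ)
    (hd : IsBPseudometric d (ball (0 : EuclideanSpace ℝ (Fin m)) 1 \ Nset) B)
    (hcomp : ∀ z ∈ ball (0 : EuclideanSpace ℝ (Fin m)) 1 \
        ⋃ i, (H i : Set (EuclideanSpace ℝ (Fin m))),
      ∀ x ∈ closure (connectedComponentIn
          (ball (0 : EuclideanSpace ℝ (Fin m)) 1 \
            ⋃ i, (H i : Set (EuclideanSpace ℝ (Fin m)))) z) ∩
        (ball (0 : EuclideanSpace ℝ (Fin m)) 1 \ Nset),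
      ∀ y ∈ closure (connectedComponentIn
          (ball (0 : EuclideanSpace ℝ (Fin m)) 1 \
            ⋃ i, (H i : Set (EuclideanSpace ℝ (Fin m)))) z) ∩
        (ball (0 : EuclideanSpace ℝ (Fin m)) 1 \ Nset),
      x ≠ y → ‖x - y‖ < 1 → d x y ≤ C₁ / |Real.log ‖x - y‖| ^ α) :
    ∀ x ∈ ball (0 : EuclideanSpace ℝ (Fin m)) 1 \ Nset,
    ∀ y ∈ ball (0 : EuclideanSpace ℝ (Fin m)) 1 \ Nset,
      (segment ℝ x y ∩ ⋃ i, (H i : Set (EuclideanSpace ℝ (Fin m)))).Nonempty →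
      segment ℝ x y ∩ Nset = ∅ →
      x ≠ y → ‖x - y‖ < 1 →
      d x y ≤ (p + 1) * B * C₁ / |Real.log ‖x - y‖| ^ α := by
  intro x hx y hy _ hseg hxy hlt
  obtain ⟨hd0, -, -, -, hchain⟩ := hd
  have hdir : ∀ i, (H i).direction < ⊤ := fun i => by
    refine lt_top_iff_ne_top.mpr fun h => ?_
    have := hHhyp i
    rw [h, finrank_top, finrank_euclideanSpace_fin] at this
    omega
  choose f hf hfH using fun i => (H i).exists_affineMap_eq_zero (hHne i) (hdir i)
  have hS : ∀ w ∈ ⋃ i, (H i : Set (EuclideanSpace ℝ (Fin m))), ∃ i, f i w = 0 := fun w hw => by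
    obtain ⟨i, hi⟩ := mem_iUnion.mp hw
    exact ⟨i, hfH i w hi⟩
  obtain ⟨s, hmono, hs0, hs1, hsmem, hsroot⟩ := exists_monotone_subdivision
    (fun i => max 0 (min 1 (-(f i x) / (f i y - f i x))))
    (fun i => le_max_left _ _) (fun i => max_le zero_le_one (min_le_left _ _))
  let γ : ℝ → EuclideanSpace ℝ (Fin m) := AffineMap.lineMap x y
  have hγseg : ∀ t ∈ Icc (0 : ℝ) 1, γ t ∈ segment ℝ x y := fun t ht => by
    rw [segment_eq_image_lineMap]
    exact mem_image_of_mem _ ht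
  have hγball : ∀ t ∈ Icc (0 : ℝ) 1, γ t ∈ ball (0 : EuclideanSpace ℝ (Fin m)) 1 := fun t ht =>
    (convex_ball 0 1).segment_subset hx.1 hy.1 (hγseg t ht)
  have hγmem : ∀ t ∈ Icc (0 : ℝ) 1, γ t ∈ ball (0 : EuclideanSpace ℝ (Fin m)) 1 \ Nset :=
    fun t ht => ⟨hγball t ht, fun hN => (hseg ▸ ⟨hγseg t ht, hN⟩ : γ t ∈ (∅ : Set _))⟩
  have hfγ : ∀ i t, f i (γ t) = (f i y - f i x) * t + f i x := fun i t => by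
    simp only [γ, AffineMap.apply_lineMap, AffineMap.lineMap_apply_ring']
    ring
  have hstep : ∀ j, d (γ (s j)) (γ (s (j + 1))) ≤ C₁ / |Real.log ‖x - y‖| ^ α := fun j => by
    rcases (hmono j.le_succ).eq_or_lt with heq | hlt'
    · rw [← heq, hd0 _ (hγmem _ (hsmem j))]
      positivity
    have hsign := fun i => affine_sign_of_clamped_root_notMem (hsmem j).1 hlt' (hsmem (j + 1)).2
      (hsroot j i)
    simp only [← hfγ] at hsign
    obtain ⟨z, hz, haz, hbz⟩ := exists_mem_closure_connectedComponentIn_diff (convex_ball 0 1)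
      isOpen_ball f hf hS (hγball _ (hsmem j)) (hγball _ (hsmem (j + 1)))
      (hγball ((s j + s (j + 1)) / 2)
        ⟨by linarith [(hsmem j).1], by linarith [(hsmem (j + 1)).2]⟩)
      (fun i => (hsign i).1) (fun i => (hsign i).2.1) (fun i => (hsign i).2.2)
    have hnorm : ‖γ (s j) - γ (s (j + 1))‖ = (s (j + 1) - s j) * ‖x - y‖ := by
      rw [← dist_eq_norm, dist_lineMap_lineMap, dist_eq_norm x y, Real.dist_eq, abs_sub_comm,
        abs_of_pos (sub_pos.mpr hlt')]
    have hxy0 : 0 < ‖x - y‖ := norm_pos_iff.mpr (sub_ne_zero.mpr hxy)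
    have hpos : 0 < ‖γ (s j) - γ (s (j + 1))‖ := by
      rw [hnorm]
      exact mul_pos (sub_pos.mpr hlt') hxy0
    have hle : ‖γ (s j) - γ (s (j + 1))‖ ≤ ‖x - y‖ := by
      rw [hnorm]
      exact mul_le_of_le_one_left hxy0.le (by linarith [(hsmem j).1, (hsmem (j + 1)).2])
    exact (hcomp z hz _ ⟨haz, hγmem _ (hsmem j)⟩ _ ⟨hbz, hγmem _ (hsmem (j + 1))⟩
      (sub_ne_zero.mp (norm_pos_iff.mp hpos)) (hle.trans_lt hlt)).trans
      (div_abs_log_rpow_le hC₁.le hα.le hpos hle hlt)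
  have hfin := hchain (p + 1) (fun j => γ (s j)) fun j _ => hγmem _ (hsmem j)
  simp only [hs0, hs1, γ, AffineMap.lineMap_apply_zero, AffineMap.lineMap_apply_one] at hfin
  calc d x y ≤ _ := hfin
    _ ≤ B * ∑ _j ∈ Finset.range (p + 1), C₁ / |Real.log ‖x - y‖| ^ α := by
      gcongr with j _
      exact hstep j
    _ = (p + 1) * B * C₁ / |Real.log ‖x - y‖| ^ α := by
      rw [Finset.sum_const, Finset.card_range, nsmul_eq_mul]
      push_cast
      ring
end
end
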